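/- Let p < m and n be positive integers with m + n > p. Define μ_p = (1/c_p)·(1 + (p/n)∫ c_p/(x−c_p) ϱ_{p/m}(x) dx). Then μ_p = (m/n)·( (√((m+n−p)n) + √(mp)) / (√(m(m+n−p)) − √(np)) )²; equivalently, if α_p, β_p ∈ (0, π/2) satisfy sin²(α_p) = p/(m+n) and sin²(β_p) = n/(m+n), then μ_p = (m/n)·tan²(α_p + β_p). -/

import Mathlib

open MeasureTheory Filter

/-- Left edge of the Marchenko–Pastur type law with ratio `d`. -/
noncomputable def aMP (d : ℝ) : ℝ := (1 - Real.sqrt d) ^ 2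

/-- Right edge of the Marchenko–Pastur type law with ratio `d`. -/
noncomputable def bMP (d : ℝ) : ℝ := (1 + Real.sqrt d) ^ 2

/-- The Marchenko–Pastur type density `ϱ_d`. -/
noncomputable def rhoMP (d x : ℝ) : ℝ :=
  if aMP d ≤ x ∧ x ≤ bMP d then
    (1 / (2 * Real.pi * d * x)) * Real.sqrt ((bMP d - x) * (x - aMP d))
  else 0

/-- The factor `√((b - x)(x - a))` of the density has derivative `(a + b - 2x) / (2√(⋯))`. -/
lemma hasDerivAt_sqrt_mul {a b x : ℝ} (hax : a < x) (hxb : x < b) :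
    HasDerivAt (fun y => √((b - y) * (y - a)))
      ((a + b - 2 * x) / (2 * √((b - x) * (x - a)))) x := by
  have hpos : (b - x) * (x - a) ≠ 0 := (mul_pos (sub_pos.2 hxb) (sub_pos.2 hax)).ne'
  have h : HasDerivAt (fun y => (b - y) * (y - a)) (a + b - 2 * x) x := by
    refine HasDerivAt.congr_deriv (((hasDerivAt_id x).const_sub b).mul ((hasDerivAt_id x).sub_const a)) ?_
    simp only [id]; ring
  exact h.sqrt hpos

lemma hasDerivAt_arcsin_affine {a b x : ℝ} (hax : a < x) (hxb : x < b) :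
    HasDerivAt (fun y => Real.arcsin ((2 * y - a - b) / (b - a)))
      (1 / √((b - x) * (x - a))) x := by
  have hab : 0 < b - a := by linarith
  have hw : 0 < (b - x) * (x - a) := mul_pos (sub_pos.2 hxb) (sub_pos.2 hax)
  have hsw := Real.sqrt_pos.2 hw
  have h : HasDerivAt (fun y => (2 * y - a - b) / (b - a)) (2 / (b - a)) x := by
    refine HasDerivAt.congr_deriv (((((hasDerivAt_id x).const_mul 2).sub_const a).sub_const b).div_const (b - a)) ?_
    simp
  have h1 : (2 * x - a - b) / (b - a) ≠ -1 := by
    rw [Ne, div_eq_iff hab.ne']; intro h; linarith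
  have h2 : (2 * x - a - b) / (b - a) ≠ 1 := by
    rw [Ne, div_eq_iff hab.ne']; intro h; linarith
  refine HasDerivAt.congr_deriv (HasDerivAt.comp (h₂ := Real.arcsin) x (Real.hasDerivAt_arcsin h1 h2) h) ?_
  have hs : √(1 - ((2 * x - a - b) / (b - a)) ^ 2) = 2 * √((b - x) * (x - a)) / (b - a) := by
    rw [Real.sqrt_eq_iff_mul_self_eq_of_pos (by positivity)]
    field_simp
    rw [Real.sq_sqrt hw.le]; ring
  rw [hs]; field_simp

lemma hasDerivAt_arcsin_moebius {a b c x : ℝ} (hca : c < a) (hax : a < x) (hxb : x < b) :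
    HasDerivAt
      (fun y => Real.arcsin (((a + b - 2 * c) * (y - c) - 2 * ((a - c) * (b - c))) /
        ((y - c) * (b - a))))
      (√((a - c) * (b - c)) / ((x - c) * √((b - x) * (x - a)))) x := by
  have hab : 0 < b - a := by linarith
  have hu : 0 < x - c := by linarith
  have hw : 0 < (b - x) * (x - a) := mul_pos (sub_pos.2 hxb) (sub_pos.2 hax)
  have hr : 0 < (a - c) * (b - c) := mul_pos (by linarith) (by linarith)
  have hsw := Real.sqrt_pos.2 hw
  have hsr := Real.sqrt_pos.2 hr
  have hden : (x - c) * (b - a) ≠ 0 := (mul_pos hu hab).ne'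
  have h : HasDerivAt (fun y => ((a + b - 2 * c) * (y - c) - 2 * ((a - c) * (b - c))) /
        ((y - c) * (b - a))) (2 * ((a - c) * (b - c)) / ((x - c) ^ 2 * (b - a))) x := by
    refine HasDerivAt.congr_deriv ((((((hasDerivAt_id x).sub_const c).const_mul (a + b - 2 * c)).sub_const
      (2 * ((a - c) * (b - c)))).div (((hasDerivAt_id x).sub_const c).mul_const (b - a)) hden)) ?_
    simp only [id]
    field_simp
    ring
  have h1 : ((a + b - 2 * c) * (x - c) - 2 * ((a - c) * (b - c))) / ((x - c) * (b - a)) ≠ -1 := by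
    rw [Ne, div_eq_iff hden]; intro h
    have : 0 < (b - c) * (x - a) := mul_pos (by linarith) (by linarith)
    linarith
  have h2 : ((a + b - 2 * c) * (x - c) - 2 * ((a - c) * (b - c))) / ((x - c) * (b - a)) ≠ 1 := by
    rw [Ne, div_eq_iff hden]; intro h
    have : 0 < (a - c) * (b - x) := mul_pos (by linarith) (by linarith)
    linarith
  refine HasDerivAt.congr_deriv (HasDerivAt.comp (h₂ := Real.arcsin) x (Real.hasDerivAt_arcsin h1 h2) h) ?_
  have hs : √(1 - (((a + b - 2 * c) * (x - c) - 2 * ((a - c) * (b - c))) /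
      ((x - c) * (b - a))) ^ 2) =
      2 * √((a - c) * (b - c)) * √((b - x) * (x - a)) / ((x - c) * (b - a)) := by
    rw [Real.sqrt_eq_iff_mul_self_eq_of_pos (by positivity)]
    field_simp
    rw [Real.sq_sqrt hw.le, Real.sq_sqrt hr.le]; ring
  rw [hs]
  field_simp
  rw [Real.sq_sqrt hr.le]

lemma continuousOn_arcsin_moebius {a b c : ℝ} (hca : c < a) (hab : a < b) :
    ContinuousOn
      (fun y => Real.arcsin (((a + b - 2 * c) * (y - c) - 2 * ((a - c) * (b - c))) /
        ((y - c) * (b - a)))) (Set.Icc a b) := by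
  refine Real.continuous_arcsin.comp_continuousOn (ContinuousOn.div (by fun_prop) (by fun_prop) ?_)
  intro y hy
  exact (mul_pos (by linarith [hy.1]) (by linarith)).ne'

lemma arcsin_moebius_left {a b c : ℝ} (hca : c < a) (hab : a < b) :
    Real.arcsin (((a + b - 2 * c) * (a - c) - 2 * ((a - c) * (b - c))) /
      ((a - c) * (b - a))) = -(Real.pi / 2) := by
  rw [← Real.arcsin_neg_one]
  congr 1
  have h1 : a - c ≠ 0 := by linarith
  have h2 : b - a ≠ 0 := by linarith
  field_simp; ring

lemma arcsin_moebius_right {a b c : ℝ} (hca : c < a) (hab : a < b) :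
    Real.arcsin (((a + b - 2 * c) * (b - c) - 2 * ((a - c) * (b - c))) /
      ((b - c) * (b - a))) = Real.pi / 2 := by
  rw [← Real.arcsin_one]
  congr 1
  have h1 : b - c ≠ 0 := by linarith
  have h2 : b - a ≠ 0 := by linarith
  field_simp; ring

lemma arcsin_affine_left {a b : ℝ} (hab : a < b) :
    Real.arcsin ((2 * a - a - b) / (b - a)) = -(Real.pi / 2) := by
  rw [← Real.arcsin_neg_one]
  congr 1
  have h2 : b - a ≠ 0 := by linarith
  field_simp; ring

lemma arcsin_affine_right {a b : ℝ} (hab : a < b) :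
    Real.arcsin ((2 * b - a - b) / (b - a)) = Real.pi / 2 := by
  rw [← Real.arcsin_one]
  congr 1
  have h2 : b - a ≠ 0 := by linarith
  field_simp; ring

lemma continuousOn_sqrt_mul_div_pow {a b c : ℝ} (hca : c < a) (k : ℕ) :
    ContinuousOn (fun x => √((b - x) * (x - a)) / (x - c) ^ k) (Set.Icc a b) := by
  refine ContinuousOn.div (by fun_prop) (by fun_prop) fun y hy => ?_
  exact pow_ne_zero k (by linarith [hy.1] : 0 < y - c).ne'

lemma intervalIntegrable_sqrt_mul_div_pow {a b c : ℝ} (hca : c < a) (hab : a < b) (k : ℕ) :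
    IntervalIntegrable (fun x => √((b - x) * (x - a)) / (x - c) ^ k) volume a b :=
  ContinuousOn.intervalIntegrable_of_Icc hab.le (continuousOn_sqrt_mul_div_pow hca k)

/-- The Stieltjes transform of the semicircle profile on `[a, b]`, to the left of `a`. -/
lemma integral_sqrt_mul_div {a b c : ℝ} (hca : c < a) (hab : a < b) :
    ∫ x in a..b, √((b - x) * (x - a)) / (x - c) ^ 1 =
      Real.pi * ((a + b) / 2 - c - √((a - c) * (b - c))) := by
  have hr : 0 < (a - c) * (b - c) := mul_pos (by linarith) (by linarith)
  have hsr := Real.sqrt_pos.2 hr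
  rw [intervalIntegral.integral_eq_sub_of_hasDerivAt_of_le hab.le
    (f := fun y => √((b - y) * (y - a)) +
      (a + b - 2 * c) / 2 * Real.arcsin ((2 * y - a - b) / (b - a)) -
      √((a - c) * (b - c)) *
        Real.arcsin (((a + b - 2 * c) * (y - c) - 2 * ((a - c) * (b - c))) /
          ((y - c) * (b - a)))) ?_ ?_ (intervalIntegrable_sqrt_mul_div_pow hca hab 1)]
  · simp only [arcsin_moebius_left hca hab, arcsin_moebius_right hca hab,
      arcsin_affine_left hab, arcsin_affine_right hab, sub_self, zero_mul, mul_zero,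
      Real.sqrt_zero]
    ring
  · have := continuousOn_arcsin_moebius hca hab
    refine ContinuousOn.sub (ContinuousOn.add (by fun_prop) ?_) (continuousOn_const.mul this)
    exact (continuous_const.mul (Real.continuous_arcsin.comp (by fun_prop))).continuousOn
  · rintro x ⟨hax, hxb⟩
    have hw : 0 < (b - x) * (x - a) := mul_pos (sub_pos.2 hxb) (sub_pos.2 hax)
    have hsw := Real.sqrt_pos.2 hw
    have hu : 0 < x - c := by linarith
    refine HasDerivAt.congr_deriv (((hasDerivAt_sqrt_mul hax hxb).add
      ((hasDerivAt_arcsin_affine hax hxb).const_mul ((a + b - 2 * c) / 2))).sub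
      ((hasDerivAt_arcsin_moebius hca hax hxb).const_mul (√((a - c) * (b - c))))) ?_
    field_simp
    rw [Real.sq_sqrt hw.le, Real.sq_sqrt hr.le]; ring

/-- The derivative of the Stieltjes transform of the semicircle profile on `[a, b]`. -/
lemma integral_sqrt_mul_div_sq {a b c : ℝ} (hca : c < a) (hab : a < b) :
    ∫ x in a..b, √((b - x) * (x - a)) / (x - c) ^ 2 =
      Real.pi * (((a + b) / 2 - c) / √((a - c) * (b - c)) - 1) := by
  have hr : 0 < (a - c) * (b - c) := mul_pos (by linarith) (by linarith)
  have hsr := Real.sqrt_pos.2 hr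
  rw [intervalIntegral.integral_eq_sub_of_hasDerivAt_of_le hab.le
    (f := fun y => -(√((b - y) * (y - a)) / (y - c)) -
      Real.arcsin ((2 * y - a - b) / (b - a)) +
      (a + b - 2 * c) / (2 * √((a - c) * (b - c))) *
        Real.arcsin (((a + b - 2 * c) * (y - c) - 2 * ((a - c) * (b - c))) /
          ((y - c) * (b - a)))) ?_ ?_ (intervalIntegrable_sqrt_mul_div_pow hca hab 2)]
  · simp only [arcsin_moebius_left hca hab, arcsin_moebius_right hca hab,
      arcsin_affine_left hab, arcsin_affine_right hab, sub_self, zero_mul, mul_zero,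
      Real.sqrt_zero, zero_div]
    field_simp
    ring
  · have := continuousOn_arcsin_moebius hca hab
    refine ContinuousOn.add (ContinuousOn.sub ?_ ?_) (continuousOn_const.mul this)
    · simpa using (continuousOn_sqrt_mul_div_pow (b := b) hca 1).fun_neg
    · exact (Real.continuous_arcsin.comp (by fun_prop)).continuousOn
  · rintro x ⟨hax, hxb⟩
    have hw : 0 < (b - x) * (x - a) := mul_pos (sub_pos.2 hxb) (sub_pos.2 hax)
    have hsw := Real.sqrt_pos.2 hw
    have hu : 0 < x - c := by linarith
    refine HasDerivAt.congr_deriv (((((hasDerivAt_sqrt_mul hax hxb).div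
      ((hasDerivAt_id x).sub_const c) hu.ne').neg).sub
      (hasDerivAt_arcsin_affine hax hxb)).add
      ((hasDerivAt_arcsin_moebius hca hax hxb).const_mul
        ((a + b - 2 * c) / (2 * √((a - c) * (b - c)))))) ?_
    simp only [id]
    field_simp
    rw [Real.sq_sqrt hw.le]; ring

lemma aMP_pos {d : ℝ} (hd1 : d < 1) : 0 < aMP d := by
  have : √d < 1 := by rw [Real.sqrt_lt' one_pos]; simpa
  exact pow_pos (by linarith) 2

lemma aMP_lt_bMP {d : ℝ} (hd : 0 < d) : aMP d < bMP d := by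
  have := Real.sqrt_pos.2 hd
  unfold aMP bMP; nlinarith

lemma aMP_add_bMP {d : ℝ} (hd : 0 < d) : aMP d + bMP d = 2 * (1 + d) := by
  unfold aMP bMP; linear_combination 2 * Real.sq_sqrt hd.le

lemma aMP_mul_bMP {d : ℝ} (hd : 0 < d) : aMP d * bMP d = (1 - d) ^ 2 := by
  unfold aMP bMP
  linear_combination (√d ^ 2 + d - 2) * Real.sq_sqrt hd.le

/-- The Stieltjes transform of the Marchenko–Pastur law, multiplied by its argument. -/
lemma integral_div_mul_rhoMP {d c : ℝ} (hd : 0 < d) (hd1 : d < 1) (hc : c < aMP d) :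
    ∫ x in (aMP d)..(bMP d), (c / (x - c)) * rhoMP d x =
      (1 - d - c - √((aMP d - c) * (bMP d - c))) / (2 * d) := by
  have ha := aMP_pos hd1
  have hab := aMP_lt_bMP hd
  have h0 : √((aMP d - 0) * (bMP d - 0)) = 1 - d := by
    rw [sub_zero, sub_zero, aMP_mul_bMP hd, Real.sqrt_sq (by linarith)]
  have h : ∫ x in (aMP d)..(bMP d), (c / (x - c)) * rhoMP d x =
      ∫ x in (aMP d)..(bMP d), (1 / (2 * Real.pi * d)) *
        (√((bMP d - x) * (x - aMP d)) / (x - c) ^ 1 -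
          √((bMP d - x) * (x - aMP d)) / (x - 0) ^ 1) := by
    refine intervalIntegral.integral_congr fun x hx => ?_
    rw [Set.uIcc_of_le hab.le] at hx
    have hx0 : x ≠ 0 := by linarith [hx.1]
    have hxc : x - c ≠ 0 := by linarith [hx.1]
    simp only [rhoMP, if_pos (show aMP d ≤ x ∧ x ≤ bMP d from hx), sub_zero]
    field_simp
    ring
  rw [h, intervalIntegral.integral_const_mul, intervalIntegral.integral_sub
    (intervalIntegrable_sqrt_mul_div_pow hc hab 1) (intervalIntegrable_sqrt_mul_div_pow ha hab 1),
    integral_sqrt_mul_div hc hab, integral_sqrt_mul_div ha hab, h0]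
  field_simp
  ring

lemma integral_div_sq_mul_rhoMP {d c : ℝ} (hd : 0 < d) (hd1 : d < 1) (hc : c < aMP d) :
    ∫ x in (aMP d)..(bMP d), (c / (x - c)) ^ 2 * rhoMP d x =
      (((1 - d) ^ 2 - (1 + d) * c) / √((aMP d - c) * (bMP d - c)) - (1 - d)) / (2 * d) := by
  have ha := aMP_pos hd1
  have hab := aMP_lt_bMP hd
  have hr : 0 < (aMP d - c) * (bMP d - c) := mul_pos (by linarith) (by linarith)
  have hsr := Real.sqrt_pos.2 hr
  have hsq : √((aMP d - c) * (bMP d - c)) ^ 2 = c ^ 2 - 2 * (1 + d) * c + (1 - d) ^ 2 := by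
    rw [Real.sq_sqrt hr.le]
    linear_combination aMP_mul_bMP hd - c * aMP_add_bMP hd
  have h : ∫ x in (aMP d)..(bMP d), (c / (x - c)) ^ 2 * rhoMP d x =
      ∫ x in (aMP d)..(bMP d), ((c / (2 * Real.pi * d)) *
        (√((bMP d - x) * (x - aMP d)) / (x - c) ^ 2) - (c / (x - c)) * rhoMP d x) := by
    refine intervalIntegral.integral_congr fun x hx => ?_
    rw [Set.uIcc_of_le hab.le] at hx
    have hx0 : x ≠ 0 := by linarith [hx.1]
    have hxc : x - c ≠ 0 := by linarith [hx.1]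
    simp only [rhoMP, if_pos (show aMP d ≤ x ∧ x ≤ bMP d from hx)]
    field_simp
    ring
  have hint : IntervalIntegrable (fun x => (c / (x - c)) * rhoMP d x) volume (aMP d) (bMP d) := by
    refine ContinuousOn.intervalIntegrable_of_Icc hab.le ?_
    have : ContinuousOn (fun x => (c / (x - c)) * ((1 / (2 * Real.pi * d)) *
        (√((bMP d - x) * (x - aMP d)) / (x - 0) ^ 1))) (Set.Icc (aMP d) (bMP d)) := by
      refine ContinuousOn.mul (ContinuousOn.div (by fun_prop) (by fun_prop) fun y hy => ?_)
        (continuousOn_const.mul (continuousOn_sqrt_mul_div_pow ha 1))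
      linarith [hy.1]
    refine this.congr fun x hx => ?_
    have hx0 : x ≠ 0 := by linarith [hx.1]
    simp only [rhoMP, if_pos (show aMP d ≤ x ∧ x ≤ bMP d from hx), sub_zero]
    field_simp
  rw [h, intervalIntegral.integral_sub
    ((intervalIntegrable_sqrt_mul_div_pow hc hab 2).const_mul _) hint,
    intervalIntegral.integral_const_mul, integral_sqrt_mul_div_sq hc hab,
    integral_div_mul_rhoMP hd hd1 hc, aMP_add_bMP hd]
  field_simp
  linear_combination hsq

/-- Solving the quadratic equation for `c`, with `s = √(p/m)`, `t = √(n/m)` and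
`q = √((m + n - p)/m)`. -/
lemma critical_point_eq {s t q c R : ℝ} (hs : 0 < s) (ht : 0 < t) (hq : 0 < q)
    (hsq : q ^ 2 = 1 + t ^ 2 - s ^ 2) (hc : 0 < c) (hca : c < (1 - s) ^ 2)
    (hR : R ^ 2 = c ^ 2 - 2 * (1 + s ^ 2) * c + (1 - s ^ 2) ^ 2)
    (hcrit : (1 - s ^ 2) ^ 2 - (1 + s ^ 2) * c = R * (q ^ 2 + t ^ 2)) :
    c * ((t + s * q) * (q + s * t)) = (1 - s ^ 2) ^ 2 * (t * q) := by
  have hprod : (c * ((t + s * q) * (q + s * t)) - (1 - s ^ 2) ^ 2 * (t * q)) *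
      (c * ((t - s * q) * (q - s * t)) - (1 - s ^ 2) ^ 2 * (t * q)) = 0 := by
    have h2 : ((1 - s ^ 2) ^ 2 - (1 + s ^ 2) * c) ^ 2 =
        (c ^ 2 - 2 * (1 + s ^ 2) * c + (1 - s ^ 2) ^ 2) * (q ^ 2 + t ^ 2) ^ 2 := by
      rw [hcrit, mul_pow, hR]
    have hK : (q ^ 2 + t ^ 2) ^ 2 = 4 * (t * q) ^ 2 + (1 - s ^ 2) ^ 2 := by
      rw [show 1 - s ^ 2 = q ^ 2 - t ^ 2 by linarith]; ring
    linear_combination (-(1 - s ^ 2) ^ 2 / 4) * h2 +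
      (-s ^ 2 * c ^ 2 - (1 - s ^ 2) ^ 2 / 4 *
        (c ^ 2 - 2 * (1 + s ^ 2) * c + (1 - s ^ 2) ^ 2)) * hK
  refine sub_eq_zero.1 ((mul_eq_zero.1 hprod).resolve_right (ne_of_lt ?_))
  have htq : 0 < t * q := mul_pos ht hq
  have h1 : c * ((t - s * q) * (q - s * t)) < c * ((1 + s) ^ 2 * (t * q)) := by
    refine mul_lt_mul_of_pos_left ?_ hc
    have : 0 < s * (q + t) ^ 2 := by positivity
    linarith
  have h2 : c * ((1 + s) ^ 2 * (t * q)) < (1 - s) ^ 2 * ((1 + s) ^ 2 * (t * q)) :=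
    mul_lt_mul_of_pos_right hca (by positivity)
  linarith

lemma critical_value_eq {s t q c R : ℝ} (hs : 0 < s) (hs1 : s < 1) (ht : 0 < t) (hq : 0 < q)
    (hsq : q ^ 2 = 1 + t ^ 2 - s ^ 2) (hc : 0 < c) (hca : c < (1 - s) ^ 2)
    (hR : R ^ 2 = c ^ 2 - 2 * (1 + s ^ 2) * c + (1 - s ^ 2) ^ 2)
    (hcrit : (1 - s ^ 2) ^ 2 - (1 + s ^ 2) * c = R * (q ^ 2 + t ^ 2)) :
    q ^ 2 + t ^ 2 - c - R = 2 * c * ((q * t + s) / (q - t * s)) ^ 2 := by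
  have hceq := critical_point_eq hs ht hq hsq hc hca hR hcrit
  have hs2 : 0 < 1 - s ^ 2 := by nlinarith
  have hden : 0 < q - t * s := by
    have : 0 < (q - t * s) * (q + t * s) := by
      have : 0 < (1 - s ^ 2) * (1 + t ^ 2) := by positivity
      linarith
    exact pos_of_mul_pos_left this (by positivity)
  have hK : 0 < q ^ 2 + t ^ 2 := by positivity
  have hS : 1 - s ^ 2 = q ^ 2 - t ^ 2 := by linarith
  have huv : (q - t * s) * (t + s * q) = (1 - s ^ 2) * (q * t + s) := by
    linear_combination s * hsq
  have hpq : (q - t * s) * (q + s * t) = (1 - s ^ 2) * (1 + t ^ 2) := by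
    linear_combination hsq
  have hv : 2 * t * q * (1 + t ^ 2) * (q * t + s) + (q - t * s) ^ 2 * (s ^ 2 - t ^ 2) =
      (q ^ 2 + t ^ 2) * (q * t + s) ^ 2 := by
    linear_combination (-(t * (2 * q * s + t * (q ^ 2 - s ^ 2)))) * hsq
  have hcv : (q - t * s) ^ 2 * (t * q) ^ 2 = c * (t * q) * (1 + t ^ 2) * (q * t + s) := by
    have h : (1 - s ^ 2) ^ 2 * ((q - t * s) ^ 2 * (t * q) ^ 2) =
        (1 - s ^ 2) ^ 2 * (c * (t * q) * (1 + t ^ 2) * (q * t + s)) := by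
      calc _ = (t * q) * c * (((q - t * s) * (t + s * q)) * ((q - t * s) * (q + s * t))) := by
            linear_combination (-((q - t * s) ^ 2 * (t * q))) * hceq
        _ = _ := by rw [huv, hpq]; ring
    exact mul_left_cancel₀ (by positivity) h
  have hmain : (q ^ 2 + t ^ 2) * (q ^ 2 + t ^ 2 - c - R) =
      4 * (t * q) ^ 2 + 2 * c * (s ^ 2 - t ^ 2) := by
    have hSS : (1 - s ^ 2) ^ 2 = (q ^ 2 - t ^ 2) ^ 2 := by rw [hS]
    linear_combination hcrit - hSS - c * hsq
  rw [div_pow, mul_div_assoc', eq_div_iff (by positivity)]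
  refine mul_left_cancel₀ hK.ne' ?_
  linear_combination (q - t * s) ^ 2 * hmain + 4 * hcv + 2 * c * hv

/-- for positive integers `p < m`, `n` with `m + n > p`, with `c_p` the unique
solution of the quadratic integral equation and
`μ_p = (1/c_p)(1 + (p/n)∫ c_p/(x−c_p) ϱ_{p/m}(x) dx)`, one has
`μ_p = (m/n)((√((m+n−p)n)+√(mp))/(√(m(m+n−p))−√(np)))²`, and equivalently
`μ_p = (m/n)·tan²(α_p+β_p)` where `sin²(α_p) = p/(m+n)`, `sin²(β_p) = n/(m+n)`
with `α_p, β_p ∈ (0, π/2)`. -/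
theorem stmt_3 (p m n : ℕ) (hp : 0 < p) (hn : 0 < n) (hpm : p < m) (hmn : p < m + n)
    (c : ℝ) (hc1 : c ∈ Set.Ioo 0 (aMP ((p : ℝ) / m)))
    (hc2 : (∫ x in (aMP ((p : ℝ) / m))..(bMP ((p : ℝ) / m)),
        (c / (x - c)) ^ 2 * rhoMP ((p : ℝ) / m) x) = (n : ℝ) / p)
    (μ : ℝ)
    (hμ : μ = (1 / c) * (1 + ((p : ℝ) / n) *
        ∫ x in (aMP ((p : ℝ) / m))..(bMP ((p : ℝ) / m)),
          (c / (x - c)) * rhoMP ((p : ℝ) / m) x))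
    (α β : ℝ) (hα : α ∈ Set.Ioo 0 (Real.pi / 2)) (hβ : β ∈ Set.Ioo 0 (Real.pi / 2))
    (hsinα : Real.sin α ^ 2 = (p : ℝ) / ((m : ℝ) + n))
    (hsinβ : Real.sin β ^ 2 = (n : ℝ) / ((m : ℝ) + n)) :
    μ = ((m : ℝ) / n) *
        ((Real.sqrt (((m : ℝ) + n - p) * n) + Real.sqrt ((m : ℝ) * p))
          / (Real.sqrt ((m : ℝ) * ((m : ℝ) + n - p)) - Real.sqrt ((n : ℝ) * p))) ^ 2 ∧
      μ = ((m : ℝ) / n) * Real.tan (α + β) ^ 2 := by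
  obtain ⟨hα0, hα1⟩ := hα
  obtain ⟨hβ0, hβ1⟩ := hβ
  obtain ⟨hc0, hca⟩ := hc1
  have hm : 0 < m := hp.trans hpm
  have hp' : (0 : ℝ) < p := by exact_mod_cast hp
  have hn' : (0 : ℝ) < n := by exact_mod_cast hn
  have hm' : (0 : ℝ) < m := by exact_mod_cast hm
  have hpm' : (p : ℝ) < m := by exact_mod_cast hpm
  have hk : (0 : ℝ) < (m : ℝ) + n - p := by linarith
  have hd : (0 : ℝ) < (p : ℝ) / m := by positivity
  have hd1 : (p : ℝ) / m < 1 := by rwa [div_lt_one hm']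
  have hab := aMP_lt_bMP hd
  have hr : 0 < (aMP ((p : ℝ) / m) - c) * (bMP ((p : ℝ) / m) - c) :=
    mul_pos (by linarith) (by linarith)
  rw [integral_div_mul_rhoMP hd hd1 hca] at hμ
  rw [integral_div_sq_mul_rhoMP hd hd1 hca] at hc2
  set R := √((aMP ((p : ℝ) / m) - c) * (bMP ((p : ℝ) / m) - c)) with hRdef
  have hRpos : 0 < R := Real.sqrt_pos.2 hr
  have hR : R ^ 2 = c ^ 2 - 2 * (1 + (p : ℝ) / m) * c + (1 - (p : ℝ) / m) ^ 2 := by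
    rw [hRdef, Real.sq_sqrt hr.le]
    linear_combination aMP_mul_bMP hd - c * aMP_add_bMP hd
  have hs2 : √((p : ℝ) / m) ^ 2 = (p : ℝ) / m := Real.sq_sqrt hd.le
  have ht2 : √((n : ℝ) / m) ^ 2 = (n : ℝ) / m := Real.sq_sqrt (by positivity)
  have hq2 : √(((m : ℝ) + n - p) / m) ^ 2 = ((m : ℝ) + n - p) / m := Real.sq_sqrt (by positivity)
  have hs1 : √((p : ℝ) / m) < 1 := by rw [Real.sqrt_lt' one_pos]; simpa
  have hqt : √(((m : ℝ) + n - p) / m) ^ 2 = 1 + √((n : ℝ) / m) ^ 2 - √((p : ℝ) / m) ^ 2 := by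
    rw [hs2, ht2, hq2]; field_simp
  have hcrit : (1 - (p : ℝ) / m) ^ 2 - (1 + (p : ℝ) / m) * c =
      R * (((m : ℝ) + n - p) / m + (n : ℝ) / m) := by
    have h : ((1 - (p : ℝ) / m) ^ 2 - (1 + (p : ℝ) / m) * c) / R =
        2 * ((p : ℝ) / m) * ((n : ℝ) / p) + (1 - (p : ℝ) / m) := by
      rw [← hc2]; field_simp; ring
    rw [div_eq_iff hRpos.ne'] at h
    rw [h]; field_simp; ring
  have key := critical_value_eq (c := c) (R := R) (Real.sqrt_pos.2 hd) hs1
    (Real.sqrt_pos.2 (by positivity : (0 : ℝ) < (n : ℝ) / m))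
    (Real.sqrt_pos.2 (by positivity : (0 : ℝ) < ((m : ℝ) + n - p) / m)) hqt hc0 hca
    (by rw [hs2]; exact hR) (by rw [hs2, hq2, ht2]; exact hcrit)
  have e1 : √(((m : ℝ) + n - p) * n) = m * (√(((m : ℝ) + n - p) / m) * √((n : ℝ) / m)) := by
    rw [Real.sqrt_eq_iff_mul_self_eq (by positivity) (by positivity), ← pow_two, mul_pow, mul_pow,
      hq2, ht2]
    field_simp
  have e2 : √((m : ℝ) * p) = m * √((p : ℝ) / m) := by
    rw [Real.sqrt_eq_iff_mul_self_eq (by positivity) (by positivity), ← pow_two, mul_pow, hs2]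
    field_simp
  have e3 : √((m : ℝ) * ((m : ℝ) + n - p)) = m * √(((m : ℝ) + n - p) / m) := by
    rw [Real.sqrt_eq_iff_mul_self_eq (by positivity) (by positivity), ← pow_two, mul_pow, hq2]
    field_simp
  have e4 : √((n : ℝ) * p) = m * (√((n : ℝ) / m) * √((p : ℝ) / m)) := by
    rw [Real.sqrt_eq_iff_mul_self_eq (by positivity) (by positivity), ← pow_two, mul_pow, mul_pow,
      hs2, ht2]
    field_simp
  have hfirst : μ = ((m : ℝ) / n) *
        ((√(((m : ℝ) + n - p) * n) + √((m : ℝ) * p))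
          / (√((m : ℝ) * ((m : ℝ) + n - p)) - √((n : ℝ) * p))) ^ 2 := by
    rw [e1, e2, e3, e4, ← mul_add, ← mul_sub, mul_div_mul_left _ _ hm'.ne']
    rw [hq2, ht2] at key
    have hY := (eq_div_of_mul_eq (by positivity : 2 * c ≠ 0)
      ((mul_comm _ _).trans key.symm))
    rw [hY, hμ]
    field_simp
    ring
  refine ⟨hfirst, hfirst.trans ?_⟩
  have hN : (0 : ℝ) < (m : ℝ) + n := by positivity
  have hsα := Real.sin_pos_of_pos_of_lt_pi hα0 (by linarith)
  have hsβ := Real.sin_pos_of_pos_of_lt_pi hβ0 (by linarith)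
  have hcα : 0 < Real.cos α := Real.cos_pos_of_mem_Ioo ⟨by linarith, hα1⟩
  have hcβ : 0 < Real.cos β := Real.cos_pos_of_mem_Ioo ⟨by linarith, hβ1⟩
  have hcosα : Real.cos α ^ 2 = ((m : ℝ) + n - p) / ((m : ℝ) + n) := by
    rw [Real.cos_sq', hsinα]; field_simp
  have hcosβ : Real.cos β ^ 2 = (m : ℝ) / ((m : ℝ) + n) := by
    rw [Real.cos_sq', hsinβ]; field_simp; ring
  have f1 : √(((m : ℝ) + n - p) * n) = ((m : ℝ) + n) * (Real.cos α * Real.sin β) := by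
    rw [Real.sqrt_eq_iff_mul_self_eq (by positivity) (by positivity), ← pow_two, mul_pow, mul_pow,
      hcosα, hsinβ]
    field_simp
  have f2 : √((m : ℝ) * p) = ((m : ℝ) + n) * (Real.sin α * Real.cos β) := by
    rw [Real.sqrt_eq_iff_mul_self_eq (by positivity) (by positivity), ← pow_two, mul_pow, mul_pow,
      hsinα, hcosβ]
    field_simp
  have f3 : √((m : ℝ) * ((m : ℝ) + n - p)) = ((m : ℝ) + n) * (Real.cos α * Real.cos β) := by
    rw [Real.sqrt_eq_iff_mul_self_eq (by positivity) (by positivity), ← pow_two, mul_pow, mul_pow,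
      hcosα, hcosβ]
    field_simp
  have f4 : √((n : ℝ) * p) = ((m : ℝ) + n) * (Real.sin α * Real.sin β) := by
    rw [Real.sqrt_eq_iff_mul_self_eq (by positivity) (by positivity), ← pow_two, mul_pow, mul_pow,
      hsinα, hsinβ]
    field_simp
  rw [f1, f2, f3, f4, ← mul_add, ← mul_sub, mul_div_mul_left _ _ hN.ne', Real.tan_eq_sin_div_cos,
    Real.sin_add, Real.cos_add, add_comm (Real.cos α * Real.sin β)]
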